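/- Let k be a field of characteristic 0, let a, b, c, u, v, m ∈ k, and let P1 = (0:1:1), P2 = (0:1:a), P3 = (1:0:1), P4 = (1:0:b), P5 = (1:1:1), P6 = (1:1:u), P7 = (m:1:v), P8 = (m:1:c) in ℙ²(k). Assume P1, …, P8 are in general position, the inequalities uvm − um − v² − vm + 2v + m − 1 ≠ 0, cv − cm − c + um² − vm − v − m² + 2m + 1 ≠ 0, and cv − cm − c + u − vm − v + m² + 2m − 1 ≠ 0 hold, and that b(cv − cm − c + um² − vm − v − m² + 2m + 1) = cuv − cu − 2cv + 2c − uv + u + 2v − 2 and a(cv − cm − c + u − vm − v + m² + 2m − 1) = cuv − cum − 2cv + 2cm − uvm + um² + 2vm − 2m². If there exists a nonzero homogeneous cubic form F ∈ k[x,y,z] that is singular at P5, vanishes at P1, P2, P3, P4, P7, P8, and vanishes at (0:0:1), then (c(v − m − 1) + um − vm − v + m² + 1) · (c(uv − u − 3v + m + 3) − uv − um² + u + vm + 3v + m² − 2m − 3) = 0. -/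

import Mathlib

open MvPolynomial

noncomputable section

variable {k : Type*} [Field k]

/-- The projective plane over `k`. -/
abbrev P2 (k : Type*) [Field k] := Projectivization k (Fin 3 → k)

/-- The point of the projective plane with homogeneous coordinates `(x : y : z)`. -/
def pt (x y z : k) (h : ![x, y, z] ≠ 0) : P2 k := Projectivization.mk k ![x, y, z] h

lemma ne_zero_fst (x y : k) : ![(1 : k), x, y] ≠ 0 :=
  fun h => (one_ne_zero : (1 : k) ≠ 0) (by simpa using congrFun h 0)

lemma ne_zero_snd (x y : k) : ![x, (1 : k), y] ≠ 0 :=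
  fun h => (one_ne_zero : (1 : k) ≠ 0) (by simpa using congrFun h 1)

lemma ne_zero_trd (x y : k) : ![x, y, (1 : k)] ≠ 0 :=
  fun h => (one_ne_zero : (1 : k) ≠ 0) (by simpa using congrFun h 2)

/-- A homogeneous form vanishes at a projective point. -/
def VanishesAt (F : MvPolynomial (Fin 3) k) (P : P2 k) : Prop :=
  eval P.rep F = 0

/-- A form is singular at a projective point: all three partial derivatives vanish there. -/
def SingularAt (F : MvPolynomial (Fin 3) k) (P : P2 k) : Prop :=
  ∀ i : Fin 3, eval P.rep (pderiv i F) = 0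

/-- `Q` lies on the line through `A` and `B`: representatives are linearly dependent. -/
def OnLine (Q A B : P2 k) : Prop :=
  ¬ LinearIndependent k ![Q.rep, A.rep, B.rep]

/-- Eight points of the projective plane are in general position. -/
def GeneralPosition (p : Fin 8 → P2 k) : Prop :=
  Function.Injective p ∧
  (∀ i j l : Fin 8, i ≠ j → i ≠ l → j ≠ l →
    LinearIndependent k ![(p i).rep, (p j).rep, (p l).rep]) ∧
  (¬ ∃ F : MvPolynomial (Fin 3) k, F ≠ 0 ∧ F.IsHomogeneous 2 ∧
    ∃ s : Finset (Fin 8), s.card = 6 ∧ ∀ i ∈ s, VanishesAt F (p i)) ∧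
  (¬ ∃ F : MvPolynomial (Fin 3) k, F ≠ 0 ∧ F.IsHomogeneous 3 ∧
    (∀ i, VanishesAt F (p i)) ∧ ∃ i, SingularAt F (p i))

/-- `P1 = (0:1:1)` -/
def p1 (k : Type*) [Field k] : P2 k := pt 0 1 1 (ne_zero_snd 0 1)
/-- `P2 = (0:1:a)` -/
def p2 (k : Type*) [Field k] (a : k) : P2 k := pt 0 1 a (ne_zero_snd 0 a)
/-- `P3 = (1:0:1)` -/
def p3 (k : Type*) [Field k] : P2 k := pt 1 0 1 (ne_zero_fst 0 1)
/-- `P4 = (1:0:b)` -/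
def p4 (k : Type*) [Field k] (b : k) : P2 k := pt 1 0 b (ne_zero_fst 0 b)
/-- `P5 = (1:1:1)` -/
def p5 (k : Type*) [Field k] : P2 k := pt 1 1 1 (ne_zero_fst 1 1)
/-- `P6 = (1:1:u)` -/
def p6 (k : Type*) [Field k] (u : k) : P2 k := pt 1 1 u (ne_zero_fst 1 u)
/-- `P7 = (m:1:v)` -/
def p7 (k : Type*) [Field k] (m v : k) : P2 k := pt m 1 v (ne_zero_snd m v)
/-- `P8 = (m:1:c)` -/
def p8 (k : Type*) [Field k] (m c : k) : P2 k := pt m 1 c (ne_zero_snd m c)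

/-- `Q = (0:0:1)` -/
def q0 (k : Type*) [Field k] : P2 k := pt 0 0 1 (ne_zero_trd 0 0)

/-- A ternary cubic form is the combination of the ten monomials of degree three. -/
lemma eq_sum_monomials_of_isHomogeneous_three {F : MvPolynomial (Fin 3) k}
    (hF : F.IsHomogeneous 3) :
    ∃ f300 f030 f003 f210 f201 f120 f021 f102 f012 f111 : k,
      F = C f300 * X 0 ^ 3 + C f030 * X 1 ^ 3 + C f003 * X 2 ^ 3 +
        C f210 * (X 0 ^ 2 * X 1) + C f201 * (X 0 ^ 2 * X 2) + C f120 * (X 0 * X 1 ^ 2) +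
        C f021 * (X 1 ^ 2 * X 2) + C f102 * (X 0 * X 2 ^ 2) + C f012 * (X 1 * X 2 ^ 2) +
        C f111 * (X 0 * X 1 * X 2) := by
  let e : (Fin 3 → ℕ) ≃ (Fin 3 →₀ ℕ) := Finsupp.equivFunOnFinite.symm
  have hsum : F = ∑ t ∈ Finset.Nat.antidiagonalTuple 3 3, monomial (e t) (coeff (e t) F) := by
    ext d
    rw [coeff_sum]
    simp only [coeff_monomial, ← Equiv.eq_symm_apply]
    rw [Finset.sum_ite_eq']
    split_ifs with h
    · simp
    · by_contra hd
      refine h (Finset.Nat.mem_antidiagonalTuple.2 ?_)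
      have := hF hd
      simpa [Finsupp.weight_apply, Finsupp.sum_fintype, e] using this
  have htup : Finset.Nat.antidiagonalTuple 3 3 =
      {![3, 0, 0], ![0, 3, 0], ![0, 0, 3], ![2, 1, 0], ![2, 0, 1], ![1, 2, 0], ![0, 2, 1],
        ![1, 0, 2], ![0, 1, 2], ![1, 1, 1]} := by decide
  have hmon (t : Fin 3 → ℕ) (r : k) :
      monomial (e t) r = C r * (X 0 ^ t 0 * X 1 ^ t 1 * X 2 ^ t 2) := by
    rw [monomial_eq, Finsupp.prod_fintype _ _ (by simp), Fin.prod_univ_three]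
    rfl
  refine ⟨coeff (e ![3, 0, 0]) F, coeff (e ![0, 3, 0]) F, coeff (e ![0, 0, 3]) F,
    coeff (e ![2, 1, 0]) F, coeff (e ![2, 0, 1]) F, coeff (e ![1, 2, 0]) F,
    coeff (e ![0, 2, 1]) F, coeff (e ![1, 0, 2]) F, coeff (e ![0, 1, 2]) F,
    coeff (e ![1, 1, 1]) F, ?_⟩
  conv_lhs => rw [hsum, htup]
  repeat rw [Finset.sum_insert (by decide)]
  simp only [Finset.sum_singleton, hmon, Matrix.cons_val]
  ring

lemma eval_smul_of_isHomogeneous {F : MvPolynomial (Fin 3) k} {n : ℕ} (hF : F.IsHomogeneous n)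
    (r : k) (w : Fin 3 → k) : eval (r • w) F = r ^ n * eval w F := by
  rw [eval_eq', eval_eq', Finset.mul_sum]
  refine Finset.sum_congr rfl fun d hd => ?_
  have hdeg := hF (mem_support_iff.1 hd)
  rw [Finsupp.weight_apply, Finsupp.sum_fintype _ _ (by simp)] at hdeg
  simp only [Pi.one_apply, smul_eq_mul, mul_one] at hdeg
  simp only [Pi.smul_apply, smul_eq_mul, mul_pow, Finset.prod_mul_distrib,
    Finset.prod_pow_eq_pow_sum, hdeg]
  ring

lemma eval_eq_zero_of_eval_rep {F : MvPolynomial (Fin 3) k} {n : ℕ} (hF : F.IsHomogeneous n)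
    {x y z : k} {h : ![x, y, z] ≠ 0} (hP : eval (pt x y z h).rep F = 0) :
    eval ![x, y, z] F = 0 := by
  obtain ⟨r, hr⟩ := Projectivization.exists_smul_eq_mk_rep k ![x, y, z] h
  rw [pt, ← hr, Units.smul_def, eval_smul_of_isHomogeneous hF] at hP
  exact (mul_eq_zero.1 hP).resolve_left (pow_ne_zero n r.ne_zero)

lemma det_ne_zero_of_linearIndependent_rep {P Q R : P2 k} {x y z x' y' z' x'' y'' z'' : k}
    {h : ![x, y, z] ≠ 0} {h' : ![x', y', z'] ≠ 0} {h'' : ![x'', y'', z''] ≠ 0}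
    (hP : P = pt x y z h) (hQ : Q = pt x' y' z' h') (hR : R = pt x'' y'' z'' h'')
    (hli : LinearIndependent k ![P.rep, Q.rep, R.rep]) :
    x * (y' * z'' - z' * y'') - y * (x' * z'' - z' * x'') + z * (x' * y'' - y' * x'') ≠ 0 := by
  subst hP hQ hR
  obtain ⟨r, hr⟩ := Projectivization.exists_smul_eq_mk_rep k ![x, y, z] h
  obtain ⟨s, hs⟩ := Projectivization.exists_smul_eq_mk_rep k ![x', y', z'] h'
  obtain ⟨t, ht⟩ := Projectivization.exists_smul_eq_mk_rep k ![x'', y'', z''] h''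
  rw [pt, pt, pt, ← hr, ← hs, ← ht] at hli
  have hdet := ((Matrix.isUnit_iff_isUnit_det _).1
    (Matrix.linearIndependent_rows_iff_isUnit (A := Matrix.of
      ![r • ![x, y, z], s • ![x', y', z'], t • ![x'', y'', z'']]).1 hli)).ne_zero
  contrapose! hdet
  simp [Matrix.det_fin_three, Units.smul_def]
  linear_combination (r * s * t : k) * hdet

theorem cubic_through_P5_forces_c
    {k : Type*} [Field k] [CharZero k] (a b c u v m : k)
    (hgen : GeneralPosition
      ![p1 k, p2 k a, p3 k, p4 k b, p5 k, p6 k u, p7 k m v, p8 k m c])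
    (h1 : u*v*m - u*m - v^2 - v*m + 2*v + m - 1 ≠ 0)
    (h2 : c*v - c*m - c + u*m^2 - v*m - v - m^2 + 2*m + 1 ≠ 0)
    (h3 : c*v - c*m - c + u - v*m - v + m^2 + 2*m - 1 ≠ 0)
    (hb : b * (c*v - c*m - c + u*m^2 - v*m - v - m^2 + 2*m + 1) =
      c*u*v - c*u - 2*c*v + 2*c - u*v + u + 2*v - 2)
    (ha : a * (c*v - c*m - c + u - v*m - v + m^2 + 2*m - 1) =
      c*u*v - c*u*m - 2*c*v + 2*c*m - u*v*m + u*m^2 + 2*v*m - 2*m^2)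
    (hF : ∃ F : MvPolynomial (Fin 3) k, F ≠ 0 ∧ F.IsHomogeneous 3 ∧
      SingularAt F (p5 k) ∧ VanishesAt F (p1 k) ∧ VanishesAt F (p2 k a) ∧
      VanishesAt F (p3 k) ∧ VanishesAt F (p4 k b) ∧ VanishesAt F (p7 k m v) ∧
      VanishesAt F (p8 k m c) ∧ VanishesAt F (q0 k)) :
    (c * (v - m - 1) + u*m - v*m - v + m^2 + 1) *
      (c * (u*v - u - 3*v + m + 3) - u*v - u*m^2 + u + v*m + 3*v + m^2 - 2*m - 3) = 0 := by
  by_contra hne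
  have ht1 := left_ne_zero_of_mul hne
  obtain ⟨-, hli, -, -⟩ := hgen
  have hm0 : m ≠ 0 := by
    rintro rfl
    exact det_ne_zero_of_linearIndependent_rep rfl rfl rfl
      (hli 0 1 6 (by decide) (by decide) (by decide)) (by ring)
  have hm1 : m ≠ 1 := by
    rintro rfl
    exact det_ne_zero_of_linearIndependent_rep rfl rfl rfl
      (hli 4 5 6 (by decide) (by decide) (by decide)) (by ring)
  have ha1 : a ≠ 1 := by
    rintro rfl
    exact det_ne_zero_of_linearIndependent_rep rfl rfl rfl
      (hli 0 1 4 (by decide) (by decide) (by decide)) (by ring)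
  have hb1 : b ≠ 1 := by
    rintro rfl
    exact det_ne_zero_of_linearIndependent_rep rfl rfl rfl
      (hli 2 3 4 (by decide) (by decide) (by decide)) (by ring)
  have hu2 : u ≠ 2 := by
    rintro rfl
    exact det_ne_zero_of_linearIndependent_rep rfl rfl rfl
      (hli 0 2 5 (by decide) (by decide) (by decide)) (by ring)
  have hcv : c ≠ v := by
    rintro rfl
    exact det_ne_zero_of_linearIndependent_rep rfl rfl rfl
      (hli 0 6 7 (by decide) (by decide) (by decide)) (by ring)
  have hv1 : v ≠ 1 := by
    rintro rfl
    exact det_ne_zero_of_linearIndependent_rep rfl rfl rfl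
      (hli 0 4 6 (by decide) (by decide) (by decide)) (by ring)
  have hc1 : c ≠ 1 := by
    rintro rfl
    exact det_ne_zero_of_linearIndependent_rep rfl rfl rfl
      (hli 0 4 7 (by decide) (by decide) (by decide)) (by ring)
  have hvm : v ≠ m := by
    rintro rfl
    exact det_ne_zero_of_linearIndependent_rep rfl rfl rfl
      (hli 2 4 6 (by decide) (by decide) (by decide)) (by ring)
  have hcm : c ≠ m := by
    rintro rfl
    exact det_ne_zero_of_linearIndependent_rep rfl rfl rfl
      (hli 2 4 7 (by decide) (by decide) (by decide)) (by ring)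
  obtain ⟨F, hF0, hF3, hS, e1, e2, e3, e4, e7, e8, e0⟩ := hF
  have s0 := eval_eq_zero_of_eval_rep hF3.pderiv (hS 0)
  have s1 := eval_eq_zero_of_eval_rep hF3.pderiv (hS 1)
  have s2 := eval_eq_zero_of_eval_rep hF3.pderiv (hS 2)
  replace e1 := eval_eq_zero_of_eval_rep hF3 e1
  replace e2 := eval_eq_zero_of_eval_rep hF3 e2
  replace e3 := eval_eq_zero_of_eval_rep hF3 e3
  replace e4 := eval_eq_zero_of_eval_rep hF3 e4
  replace e7 := eval_eq_zero_of_eval_rep hF3 e7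
  replace e8 := eval_eq_zero_of_eval_rep hF3 e8
  replace e0 := eval_eq_zero_of_eval_rep hF3 e0
  obtain ⟨f300, f030, f003, f210, f201, f120, f021, f102, f012, f111, rfl⟩ :=
    eq_sum_monomials_of_isHomogeneous_three hF3
  simp [pderiv_X, Derivation.leibniz, Derivation.leibniz_pow] at s0 s1 s2 e0 e1 e2 e3 e4 e7 e8
  have h021 : f021 = -(1 + a) * f012 := by
    refine mul_left_cancel₀ (sub_ne_zero.2 ha1) ?_
    linear_combination e2 - e1 + (1 - a ^ 3) * e0
  have h030 : f030 = a * f012 := by linear_combination e1 - e0 - h021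
  have h201 : f201 = -(1 + b) * f102 := by
    refine mul_left_cancel₀ (sub_ne_zero.2 hb1) ?_
    linear_combination e4 - e3 + (1 - b ^ 3) * e0
  have h300 : f300 = b * f102 := by linear_combination e3 - e0 - h201
  have hsum : f210 + f120 + f111 = 0 := by
    refine (mul_eq_zero.1 ?_).resolve_left (three_ne_zero (α := k))
    linear_combination s0 + s1 + s2 - 3 * e0 - 3 * h021 - 3 * h030 - 3 * h201 - 3 * h300
  have h210 : f210 = (1 - b) * f102 := by
    linear_combination s0 - hsum - 3 * h300 - 2 * h201
  have h120 : f120 = (1 - a) * f012 := by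
    linear_combination s1 - hsum - 3 * h030 - 2 * h021
  have h111 : f111 = -(1 - b) * f102 - (1 - a) * f012 := by
    linear_combination hsum - h210 - h120
  subst h021 h030 h201 h300 h210 h120 h111 e0
  have e7' : f012 * ((v - 1) * (v - a - (1 - a) * m)) +
      f102 * (m * (v - m) * (v - b * m - (1 - b))) = 0 := by linear_combination e7
  have e8' : f012 * ((c - 1) * (c - a - (1 - a) * m)) +
      f102 * (m * (c - m) * (c - b * m - (1 - b))) = 0 := by linear_combination e8
  set A := c*v - c*m - c + u - v*m - v + m^2 + 2*m - 1 with hA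
  set B := c*v - c*m - c + u*m^2 - v*m - v - m^2 + 2*m + 1 with hB
  set T := c * (v - m - 1) + u*m - v*m - v + m^2 + 1 with hT
  have hdet : A * B * ((v - 1) * (v - a - (1 - a) * m) * ((c - m) * (c - b * m - (1 - b))) -
      (c - 1) * (c - a - (1 - a) * m) * ((v - m) * (v - b * m - (1 - b)))) =
      2 * T * (c - v) * (m - 1) * (c - 1) * (v - 1) * (c - m) * (v - m) * (u - 2) := by
    have hL (z : k) : A * (z - a - (1 - a) * m) = z * A - A * m - (1 - m) *
        (c*u*v - c*u*m - 2*c*v + 2*c*m - u*v*m + u*m^2 + 2*v*m - 2*m^2) := by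
      linear_combination (m - 1) * ha
    have hM (z : k) : B * (z - b * m - (1 - b)) = z * B - B - (m - 1) *
        (c*u*v - c*u - 2*c*v + 2*c - u*v + u + 2*v - 2) := by
      linear_combination (1 - m) * hb
    calc
      _ = (v - 1) * (A * (v - a - (1 - a) * m)) * ((c - m) * (B * (c - b * m - (1 - b)))) -
          (c - 1) * (A * (c - a - (1 - a) * m)) * ((v - m) * (B * (v - b * m - (1 - b)))) := by
        ring
      _ = _ := by
        rw [hL, hL, hM, hM, hA, hB, hT]
        ring
  have hD := right_ne_zero_of_mul (hdet.trans_ne (by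
    simp [ht1, sub_ne_zero, hcv, hm1, hc1, hv1, hcm, hvm, hu2]))
  have h012 : f012 = 0 := by
    refine (mul_eq_zero.1 ?_).resolve_right hD
    linear_combination (c - m) * (c - b * m - (1 - b)) * e7' -
      (v - m) * (v - b * m - (1 - b)) * e8'
  have h102 : f102 = 0 := by
    refine (mul_eq_zero.1 ?_).resolve_right (mul_ne_zero hm0 hD)
    linear_combination (v - 1) * (v - a - (1 - a) * m) * e8' -
      (c - 1) * (c - a - (1 - a) * m) * e7'
  exact hF0 (by simp [h012, h102])

end
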